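/- Let f be a monotone submodular function with f(OPT) ≥ v, let o₁, o₂ ∈ OPT, and let e₀ be any element. If f({e₀, o₁}) < β·v then f(OPT \ {o₁} | {e₀}) ≥ (1-β)·v. If additionally f({e₀, o₂}) < β·v, then f(OPT \ {o₁, o₂} | {e₀}) ≥ (1 - 2β + f({e₀})/v)·v. -/

import Mathlib

/-- Diminishing returns for a monotone function, without assuming that the added element is new. -/
theorem marginal_insert_le_of_subset {E : Type*} [DecidableEq E] {f : Finset E → ℝ}
    (hmono : ∀ ⦃A B : Finset E⦄, A ⊆ B → f A ≤ f B)
    (hsub : ∀ ⦃A B : Finset E⦄, A ⊆ B → ∀ e ∉ B,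
      f (insert e B) - f B ≤ f (insert e A) - f A)
    {A B : Finset E} (hAB : A ⊆ B) (e : E) :
    f (insert e B) - f B ≤ f (insert e A) - f A := by
  by_cases he : e ∈ B
  · rw [Finset.insert_eq_of_mem he, sub_self]
    exact sub_nonneg.2 (hmono (Finset.subset_insert e A))
  · exact hsub hAB e he

/-- Erasing `o` from `S` costs at most the marginal value of `o` over `{e}`, in the presence of
`e`. -/
theorem union_singleton_sub_erase_le {E : Type*} [DecidableEq E] {f : Finset E → ℝ}
    (hmono : ∀ ⦃A B : Finset E⦄, A ⊆ B → f A ≤ f B)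
    (hsub : ∀ ⦃A B : Finset E⦄, A ⊆ B → ∀ e ∉ B,
      f (insert e B) - f B ≤ f (insert e A) - f A)
    (S : Finset E) (o e : E) :
    f (S ∪ {e}) - f (S.erase o ∪ {e}) ≤ f {e, o} - f {e} := by
  have hmarg := marginal_insert_le_of_subset hmono hsub
    (Finset.subset_union_right : {e} ⊆ S.erase o ∪ {e}) o
  have hle : f (S ∪ {e}) ≤ f (insert o (S.erase o ∪ {e})) := by
    rw [← Finset.insert_union]
    exact hmono (Finset.union_subset_union_left (Finset.insert_erase_subset o S))
  rw [Finset.pair_comm e o]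
  linarith

/-- Lemma 4.2: bounds on the marginal value of `OPT - o₁` (resp. `OPT - o₁ - o₂`)
with respect to a candidate element `e₀`. -/
theorem good_item_marginals {E : Type*} [DecidableEq E]
    (f : Finset E → ℝ) (v β : ℝ)
    (hmono : ∀ ⦃A B : Finset E⦄, A ⊆ B → f A ≤ f B)
    (hsub : ∀ ⦃A B : Finset E⦄, A ⊆ B → ∀ e ∉ B,
      f (insert e B) - f B ≤ f (insert e A) - f A)
    (hf0 : f ∅ = 0) (hv : 0 < v)
    (OPT : Finset E) (o₁ o₂ e₀ : E)
    (ho₁ : o₁ ∈ OPT) (ho₂ : o₂ ∈ OPT) (hne : o₁ ≠ o₂)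
    (hOPT : f OPT ≥ v) :
    (f {e₀, o₁} < β * v →
      f ((OPT.erase o₁) ∪ {e₀}) - f {e₀} ≥ (1 - β) * v) ∧
    (f {e₀, o₁} < β * v → f {e₀, o₂} < β * v →
      f (((OPT.erase o₁).erase o₂) ∪ {e₀}) - f {e₀}
        ≥ (1 - 2 * β + f {e₀} / v) * v) := by
  have hunion : f OPT ≤ f (OPT ∪ {e₀}) := hmono Finset.subset_union_left
  have herase₁ := union_singleton_sub_erase_le hmono hsub OPT o₁ e₀
  refine ⟨fun h₁ => by linarith, fun h₁ h₂ => ?_⟩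
  have herase₂ := union_singleton_sub_erase_le hmono hsub (OPT.erase o₁) o₂ e₀
  rw [add_mul, div_mul_cancel₀ _ hv.ne']
  linarith
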